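/- Let u : ℝⁿ × (0,∞) → ℝ be a classical supersolution (C² in the space variable and C¹ in the time variable on ℝⁿ × (0,∞), continuous up to t = 0) satisfying u_t ≥ Δu + |u|^p V on ℝⁿ × (0,∞), where Δ is the Laplacian in the space variables. Assume u is bounded from below, u(·,0) = u₀ ≥ 0, V : ℝⁿ × (0,∞) → ℝ is continuous and positive, V satisfies the conditions (VOL) with exponent α > 0, and 1 < p ≤ 1 + 2/α. Then u ≡ 0 on ℝⁿ × [0,∞). -/

import Mathlib

open MeasureTheory Real Set

/-- The Laplacian in the space variables on Euclidean space: the sum of the pure second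
directional derivatives along the standard coordinate directions. -/
noncomputable def laplacian {n : ℕ} (f : EuclideanSpace ℝ (Fin n) → ℝ)
    (x : EuclideanSpace ℝ (Fin n)) : ℝ :=
  ∑ i, fderiv ℝ (fun y => fderiv ℝ f y (EuclideanSpace.single i 1)) x (EuclideanSpace.single i 1)

open Topology Filter in
lemma second_deriv_nonneg_of_isLocalMin {g g' : ℝ → ℝ} {c : ℝ}
    (hg : ∀ s, HasDerivAt g (g' s) s) (hg' : HasDerivAt g' c 0) (hmin : IsLocalMin g 0) :
    0 ≤ c := by
  by_contra hc
  push Not at hc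
  have hd : deriv g = g' := funext fun s => (hg s).deriv
  have h0 : g' 0 = 0 := by rw [← (hg 0).deriv]; exact hmin.deriv_eq_zero
  have hmax : IsLocalMax g 0 := by
    apply isLocalMax_of_deriv_deriv_neg
    · rw [hd, hg'.deriv]; exact hc
    · rw [hd, h0]
    · exact (hg 0).continuousAt
  have hconst : g =ᶠ[𝓝 0] fun _ => g 0 := by
    filter_upwards [hmax, hmin] with s h1 h2 using le_antisymm h1 h2
  have h1 : deriv g =ᶠ[𝓝 0] fun _ => 0 := by
    have := hconst.deriv
    simpa using this
  rw [hd] at h1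
  have h2 := h1.deriv_eq
  rw [hg'.deriv] at h2
  simp at h2
  linarith

lemma differentiable_fderiv_apply {n : ℕ} {f : EuclideanSpace ℝ (Fin n) → ℝ}
    (hf : ContDiff ℝ 2 f) (v : EuclideanSpace ℝ (Fin n)) :
    ContDiff ℝ 1 (fun y => fderiv ℝ f y v) := by
  have : ContDiff ℝ 1 (fderiv ℝ f) := hf.fderiv_right (by norm_num)
  exact this.clm_apply contDiff_const

open Topology Filter in
lemma laplacian_nonneg_of_isLocalMin {n : ℕ} {f : EuclideanSpace ℝ (Fin n) → ℝ}
    (hf : ContDiff ℝ 2 f) {x : EuclideanSpace ℝ (Fin n)} (hx : IsLocalMin f x) :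
    0 ≤ laplacian f x := by
  unfold laplacian
  apply Finset.sum_nonneg
  intro i _
  set e : EuclideanSpace ℝ (Fin n) := EuclideanSpace.single i 1
  have hline : ∀ s : ℝ, HasDerivAt (fun s : ℝ => x + s • e) e s := by
    intro s
    simpa using ((hasDerivAt_id s).smul_const e).const_add x
  apply second_deriv_nonneg_of_isLocalMin (g := fun s => f (x + s • e))
    (g' := fun s => fderiv ℝ f (x + s • e) e)
  · intro s
    have := (hf.differentiable (by norm_num) (x + s • e)).hasFDerivAt.comp_hasDerivAt s (hline s)
    exact this
  · have h1 := ((differentiable_fderiv_apply hf e).differentiable (by norm_num) (x + (0:ℝ) • e)).hasFDerivAt.comp_hasDerivAt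
      (0:ℝ) (hline 0)
    simp only [zero_smul, add_zero] at h1
    exact h1
  · have hc : ContinuousAt (fun s : ℝ => x + s • e) 0 := (hline 0).continuousAt
    have h0 : x + (0:ℝ) • e = x := by simp
    have : Tendsto (fun s : ℝ => x + s • e) (𝓝 0) (𝓝 x) := by
      have := hc.tendsto; rwa [h0] at this
    have h3 := this.eventually hx
    unfold IsLocalMin IsMinFilter
    simpa using h3

lemma laplacian_add {n : ℕ} {f g : EuclideanSpace ℝ (Fin n) → ℝ}
    (hf : ContDiff ℝ 2 f) (hg : ContDiff ℝ 2 g) (x : EuclideanSpace ℝ (Fin n)) :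
    laplacian (fun y => f y + g y) x = laplacian f x + laplacian g x := by
  unfold laplacian
  rw [← Finset.sum_add_distrib]
  apply Finset.sum_congr rfl
  intro i _
  have h1 : (fun y => fderiv ℝ (fun y => f y + g y) y (EuclideanSpace.single i 1)) =
      fun y => fderiv ℝ f y (EuclideanSpace.single i 1) + fderiv ℝ g y (EuclideanSpace.single i 1) := by
    funext y
    rw [fderiv_fun_add (hf.differentiable (by norm_num) y) (hg.differentiable (by norm_num) y)]
    rfl
  rw [h1, fderiv_fun_add ((differentiable_fderiv_apply hf _).differentiable (by norm_num) x)
    ((differentiable_fderiv_apply hg _).differentiable (by norm_num) x)]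
  rfl

lemma laplacian_neg {n : ℕ} (f : EuclideanSpace ℝ (Fin n) → ℝ) (x : EuclideanSpace ℝ (Fin n)) :
    laplacian (fun y => - f y) x = - laplacian f x := by
  unfold laplacian
  rw [← Finset.sum_neg_distrib]
  apply Finset.sum_congr rfl
  intro i _
  have h1 : (fun y => fderiv ℝ (fun y => - f y) y (EuclideanSpace.single i 1)) =
      fun y => - fderiv ℝ f y (EuclideanSpace.single i 1) := by
    funext y
    rw [fderiv_fun_neg]
    rfl
  rw [h1, fderiv_fun_neg]
  rfl

lemma hasFDerivAt_normsq {n : ℕ} (x₁ y : EuclideanSpace ℝ (Fin n)) :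
    HasFDerivAt (fun y : EuclideanSpace ℝ (Fin n) => ‖y - x₁‖ ^ 2)
      (2 • (innerSL ℝ (y - x₁))) y := by
  have := ((hasFDerivAt_id y).sub_const x₁).norm_sq
  simpa using this

lemma laplacian_quad {n : ℕ} (δ d : ℝ) (x₁ x : EuclideanSpace ℝ (Fin n)) :
    laplacian (fun y => δ * ‖y - x₁‖ ^ 2 + d) x = 2 * n * δ := by
  unfold laplacian
  have h1 : ∀ i : Fin n, (fun y => fderiv ℝ (fun y : EuclideanSpace ℝ (Fin n) => δ * ‖y - x₁‖ ^ 2 + d) y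
      (EuclideanSpace.single i 1)) = fun y => δ * (2 * (y i - x₁ i)) := by
    intro i
    funext y
    rw [(((hasFDerivAt_normsq x₁ y).const_mul δ).add_const d).fderiv]
    simp [EuclideanSpace.inner_single_right]
  have h2 : ∀ i : Fin n, fderiv ℝ (fun y : EuclideanSpace ℝ (Fin n) => δ * (2 * (y i - x₁ i))) x
      (EuclideanSpace.single i 1) = 2 * δ := by
    intro i
    have h3 : HasFDerivAt (fun y : EuclideanSpace ℝ (Fin n) => y i)
      (EuclideanSpace.proj i : EuclideanSpace ℝ (Fin n) →L[ℝ] ℝ) x :=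
      (EuclideanSpace.proj i : EuclideanSpace ℝ (Fin n) →L[ℝ] ℝ).hasFDerivAt
    rw [(((h3.sub_const (x₁ i)).const_mul 2).const_mul δ).fderiv]
    simp
    ring
  simp_rw [h1, h2]
  simp
  ring

lemma contDiff_quad {n : ℕ} (δ d : ℝ) (x₁ : EuclideanSpace ℝ (Fin n)) :
    ContDiff ℝ 2 (fun y : EuclideanSpace ℝ (Fin n) => δ * ‖y - x₁‖ ^ 2 + d) := by
  have : ContDiff ℝ 2 (fun y : EuclideanSpace ℝ (Fin n) => ‖y - x₁‖ ^ 2) :=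
    (contDiff_id.sub contDiff_const).norm_sq ℝ
  exact (contDiff_const.mul this).add contDiff_const

open Topology Filter in
lemma deriv_nonpos_of_left_min {g : ℝ → ℝ} {a s c : ℝ} (has : a < s) (hg : HasDerivAt g c s)
    (hmin : ∀ r ∈ Icc a s, g s ≤ g r) : c ≤ 0 := by
  have h1 := hg.hasDerivWithinAt (s := Iio s)
  rw [hasDerivWithinAt_iff_tendsto_slope' (by simp)] at h1
  refine le_of_tendsto h1 ?_
  filter_upwards [Ioo_mem_nhdsLT has] with r hr
  rw [slope_def_field]
  apply div_nonpos_of_nonneg_of_nonpos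
  · linarith [hmin r ⟨hr.1.le, hr.2.le⟩]
  · linarith [hr.2]

/-- Parabolic minimum principle on a cylinder, with separate regularity only. -/
lemma parabolic_min {n : ℕ} (D : EuclideanSpace ℝ (Fin n) → ℝ → ℝ)
    (x₁ : EuclideanSpace ℝ (Fin n)) (r a b : ℝ) (hr : 0 < r) (hab : a ≤ b)
    (hc : ContinuousOn (fun q : EuclideanSpace ℝ (Fin n) × ℝ => D q.1 q.2)
      (Metric.closedBall x₁ r ×ˢ Icc a b))
    (hbot : ∀ x ∈ Metric.closedBall x₁ r, 0 ≤ D x a)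
    (hside : ∀ x ∈ Metric.sphere x₁ r, ∀ s ∈ Icc a b, 0 ≤ D x s)
    (hsp : ∀ s ∈ Ioc a b, ContDiff ℝ 2 (fun x => D x s))
    (ht : ∀ x, ∀ s ∈ Ioc a b, DifferentiableAt ℝ (fun s => D x s) s)
    (hstrict : ∀ x ∈ Metric.closedBall x₁ r, ∀ s ∈ Ioc a b,
      laplacian (fun y => D y s) x < deriv (fun s => D x s) s) :
    ∀ x ∈ Metric.closedBall x₁ r, ∀ s ∈ Icc a b, 0 ≤ D x s := by
  have hcomp : IsCompact (Metric.closedBall x₁ r ×ˢ Icc a b) :=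
    (isCompact_closedBall x₁ r).prod isCompact_Icc
  obtain ⟨⟨x, s⟩, ⟨hx, hs⟩, hmin⟩ := hcomp.exists_isMinOn
    ⟨(x₁, a), by simp [hr.le], by simp [hab]⟩ hc
  simp only at hx hs
  have hmin' : ∀ y ∈ Metric.closedBall x₁ r, ∀ r ∈ Icc a b, D x s ≤ D y r :=
    fun y hy r hr => hmin (show (y, r) ∈ _ from ⟨hy, hr⟩)
  suffices h : 0 ≤ D x s from fun y hy r hr => h.trans (hmin' y hy r hr)
  rcases eq_or_lt_of_le hs.1 with h | h
  · rw [← h]; exact hbot x hx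
  rcases eq_or_lt_of_le (Metric.mem_closedBall.1 hx) with h' | h'
  · exact hside x h' s hs
  exfalso
  have h1 := hstrict x hx s ⟨h, hs.2⟩
  have h2 : deriv (fun s => D x s) s ≤ 0 := by
    apply deriv_nonpos_of_left_min h (ht x s ⟨h, hs.2⟩).hasDerivAt
    intro r hr
    exact hmin' x hx r ⟨hr.1, hr.2.trans hs.2⟩
  have h3 : 0 ≤ laplacian (fun y => D y s) x := by
    apply laplacian_nonneg_of_isLocalMin (hsp s ⟨h, hs.2⟩)
    filter_upwards [Metric.isOpen_ball.mem_nhds (Metric.mem_ball.2 h')] with y hy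
    exact hmin' y (Metric.ball_subset_closedBall hy) s hs
  linarith

/-- A bounded below classical supersolution of the heat equation with nonnegative
initial datum is nonnegative. -/
lemma supersol_nonneg {n : ℕ} (u : EuclideanSpace ℝ (Fin n) → ℝ → ℝ)
    (hu_cont : ContinuousOn (fun q : EuclideanSpace ℝ (Fin n) × ℝ => u q.1 q.2)
      {q : EuclideanSpace ℝ (Fin n) × ℝ | 0 ≤ q.2})
    (hu_space : ∀ t : ℝ, 0 < t → ContDiff ℝ 2 (fun x => u x t))
    (hu_time : ∀ x, ∀ t : ℝ, 0 < t → DifferentiableAt ℝ (fun s => u x s) t)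
    (hbelow : ∃ A : ℝ, ∀ x, ∀ t : ℝ, 0 ≤ t → A ≤ u x t)
    (h0 : ∀ x, 0 ≤ u x 0)
    (hpde : ∀ x, ∀ t : ℝ, 0 < t → laplacian (fun y => u y t) x ≤ deriv (fun s => u x s) t) :
    ∀ x, ∀ t : ℝ, 0 ≤ t → 0 ≤ u x t := by
  obtain ⟨A, hA⟩ := hbelow
  intro x₁ t ht
  have key : ∀ ε : ℝ, 0 < ε → 0 ≤ u x₁ t + ε * ((2 * n + 1) * t) := by
    intro ε hε
    obtain ⟨r, hr, hr2⟩ : ∃ r : ℝ, 0 < r ∧ 0 ≤ A + ε * r ^ 2 := by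
      refine ⟨|A| / ε + 1, by positivity, ?_⟩
      have h1 : |A| / ε ≤ (|A| / ε + 1) ^ 2 := by
        have : 0 ≤ |A| / ε := by positivity
        nlinarith
      have h2 : |A| ≤ ε * (|A| / ε + 1) ^ 2 := by
        calc |A| = ε * (|A| / ε) := by field_simp
          _ ≤ _ := by gcongr
      linarith [neg_abs_le A]
    have := parabolic_min (fun x s => u x s + (ε * ‖x - x₁‖ ^ 2 + ε * ((2 * n + 1) * s))) x₁ r 0 t hr ht
      ?_ ?_ ?_ ?_ ?_ ?_ x₁ (by simp [hr.le]) t ⟨ht, le_rfl⟩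
    · simpa using this
    · apply ContinuousOn.add
      · exact hu_cont.mono fun q hq => hq.2.1
      · fun_prop
    · intro x _
      have := h0 x
      have : 0 ≤ ε * ‖x - x₁‖ ^ 2 := by positivity
      simp
      linarith
    · intro x hx s hs
      have h1 : ‖x - x₁‖ = r := by simpa [dist_eq_norm] using hx
      have h2 := hA x s hs.1
      have : 0 ≤ ε * ((2 * n + 1) * s) := by have := hs.1; positivity
      simp only [h1]
      linarith
    · intro s hs
      exact (hu_space s hs.1).add (contDiff_quad ε _ x₁)
    · intro x s hs
      apply (hu_time x s hs.1).add
      fun_prop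
    · intro x _ s hs
      rw [laplacian_add (hu_space s hs.1) (contDiff_quad ε _ x₁), laplacian_quad]
      have hd : HasDerivAt (fun s : ℝ => ε * ‖x - x₁‖ ^ 2 + ε * ((2 * n + 1) * s))
          (ε * ((2 * n + 1))) s := by
        have := (((hasDerivAt_id s).const_mul (2 * (n:ℝ) + 1)).const_mul ε).const_add (ε * ‖x - x₁‖ ^ 2)
        simpa using this
      rw [((hu_time x s hs.1).hasDerivAt.fun_add hd).deriv]
      have := hpde x s hs.1
      nlinarith
  by_contra hneg
  push Not at hneg
  have hM : 0 ≤ (2 * (n:ℝ) + 1) * t := by positivity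
  set M := (2 * (n:ℝ) + 1) * t
  have h1 := key (-u x₁ t / (2 * (M + 1))) (by apply div_pos <;> linarith)
  have h2 : -u x₁ t / (2 * (M + 1)) * M ≤ -u x₁ t / 2 := by
    rw [div_mul_eq_mul_div, div_le_div_iff₀ (by positivity) (by norm_num)]
    nlinarith
  linarith

lemma continuous_laplacian {n : ℕ} {f : EuclideanSpace ℝ (Fin n) → ℝ}
    (hf : ContDiff ℝ 2 f) : Continuous (laplacian f) := by
  unfold laplacian
  apply continuous_finsetSum
  intro i _
  have := (differentiable_fderiv_apply hf (EuclideanSpace.single i 1)).continuous_fderiv (by norm_num)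
  exact this.clm_apply continuous_const

/-- Locally uniform one-sided lower bound for forward difference quotients in time. -/
lemma forward_quotient {n : ℕ} (u f : EuclideanSpace ℝ (Fin n) → ℝ → ℝ)
    (hu_cont : ContinuousOn (fun q : EuclideanSpace ℝ (Fin n) × ℝ => u q.1 q.2)
      {q : EuclideanSpace ℝ (Fin n) × ℝ | 0 < q.2})
    (hu_space : ∀ t : ℝ, 0 < t → ContDiff ℝ 2 (fun x => u x t))
    (hu_time : ∀ x, ∀ t : ℝ, 0 < t → DifferentiableAt ℝ (fun s => u x s) t)
    (hf_cont : ContinuousOn (fun q : EuclideanSpace ℝ (Fin n) × ℝ => f q.1 q.2)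
      {q : EuclideanSpace ℝ (Fin n) × ℝ | 0 < q.2})
    (hpde : ∀ x, ∀ t : ℝ, 0 < t →
      laplacian (fun y => u y t) x + f x t ≤ deriv (fun s => u x s) t)
    (x₀ : EuclideanSpace ℝ (Fin n)) (R t ε : ℝ) (ht : 0 < t) (hε : 0 < ε) :
    ∃ h₀ > 0, ∀ h ∈ Ioo 0 h₀, ∀ x ∈ Metric.closedBall x₀ R,
      u x t + h * (laplacian (fun y => u y t) x + f x t - ε) ≤ u x (t + h) := by
  set K := Metric.closedBall x₀ (R + 1) with hK
  have hKc : IsCompact K := isCompact_closedBall _ _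
  have hQc : IsCompact (K ×ˢ Icc t (t + 1)) := hKc.prod isCompact_Icc
  have hQsub : K ×ˢ Icc t (t + 1) ⊆ {q : EuclideanSpace ℝ (Fin n) × ℝ | 0 < q.2} :=
    fun q hq => lt_of_lt_of_le ht hq.2.1
  have hlapc := continuous_laplacian (hu_space t ht)
  have hf_uc := hQc.uniformContinuousOn_of_continuous (hf_cont.mono hQsub)
  have hu_uc := hQc.uniformContinuousOn_of_continuous (hu_cont.mono hQsub)
  have hl_uc := hKc.uniformContinuousOn_of_continuous hlapc.continuousOn
  rw [Metric.uniformContinuousOn_iff] at hf_uc hu_uc hl_uc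
  obtain ⟨d1, hd1, Hf⟩ := hf_uc (ε / 3) (by positivity)
  obtain ⟨d2, hd2, Hl⟩ := hl_uc (ε / 3) (by positivity)
  set r := min (min (d1 / 2) (d2 / 2)) 1 with hr_def
  have hr : 0 < r := by positivity
  have hr1 : r ≤ d1 / 2 := (min_le_left _ _).trans (min_le_left _ _)
  have hr2 : r ≤ d2 / 2 := (min_le_left _ _).trans (min_le_right _ _)
  have hr3 : r ≤ 1 := min_le_right _ _
  set δ := ε / (3 * (2 * n + 1)) with hδ_def
  have hδ : 0 < δ := by positivity
  have hδn : 2 * n * δ < ε / 3 := by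
    have : (2 * n + 1) * δ = ε / 3 := by rw [hδ_def]; field_simp
    linarith
  obtain ⟨d3, hd3, Hu⟩ := hu_uc (δ * r ^ 2 / 2) (by positivity)
  have hc_cont : ContinuousOn (fun x => laplacian (fun y => u y t) x + f x t - ε) K := by
    refine (hlapc.continuousOn.add ?_).sub continuousOn_const
    exact hf_cont.comp (f := fun x => (x, t)) (by fun_prop) (fun x _ => ht)
  obtain ⟨M, hM⟩ := hKc.exists_bound_of_continuousOn hc_cont
  set M' := |M| + 1
  have hM' : 0 < M' := by positivity
  refine ⟨min (min (d1 / 2) (d3 / 2)) (min (δ * r ^ 2 / 2 / M') 1), by positivity, ?_⟩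
  intro h hh x₁ hx₁
  have hh0 := hh.1
  have hh1 : h < d1 / 2 := lt_of_lt_of_le hh.2 ((min_le_left _ _).trans (min_le_left _ _))
  have hh2 : h < d3 / 2 := lt_of_lt_of_le hh.2 ((min_le_left _ _).trans (min_le_right _ _))
  have hh3 : h < δ * r ^ 2 / 2 / M' := lt_of_lt_of_le hh.2 ((min_le_right _ _).trans (min_le_left _ _))
  have hh4 : h < 1 := lt_of_lt_of_le hh.2 ((min_le_right _ _).trans (min_le_right _ _))
  have hsub : Metric.closedBall x₁ r ⊆ K := by
    apply Metric.closedBall_subset_closedBall'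
    have := Metric.mem_closedBall.1 hx₁
    linarith
  have hx₁K : x₁ ∈ K := hsub (Metric.mem_closedBall_self hr.le)
  set c := laplacian (fun y => u y t) x₁ + f x₁ t - ε with hc
  have hcM : |c| ≤ M' := by
    have := hM x₁ hx₁K
    rw [Real.norm_eq_abs] at this
    exact this.trans ((le_abs_self M).trans (by simp [M']))
  have hch : ∀ s ∈ Icc t (t + h), |c * (s - t)| ≤ δ * r ^ 2 / 2 := by
    intro s hs
    rw [abs_mul, abs_of_nonneg (sub_nonneg.2 hs.1)]
    calc |c| * (s - t) ≤ M' * h := by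
          apply mul_le_mul hcM (by linarith [hs.2]) (by linarith [hs.1]) hM'.le
      _ ≤ M' * (δ * r ^ 2 / 2 / M') := by gcongr
      _ = _ := by field_simp
  have := parabolic_min (fun x s => u x s + (- u x t + (δ * ‖x - x₁‖ ^ 2 + (- (c * (s - t)))))) x₁ r t (t + h) hr
      (by linarith) ?_ ?_ ?_ ?_ ?_ ?_ x₁ (by simp [hr.le]) (t + h) ⟨by linarith, le_rfl⟩
  · simp at this
    linarith
  · apply ContinuousOn.add
    · exact hu_cont.mono fun q hq => lt_of_lt_of_le ht hq.2.1
    apply ContinuousOn.add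
    · apply ContinuousOn.neg
      exact ((hu_space t ht).continuous.comp continuous_fst).continuousOn
    · fun_prop
  · intro x _
    have : 0 ≤ δ * ‖x - x₁‖ ^ 2 := by positivity
    simp
    linarith
  · intro x hx s hs
    have h1 : ‖x - x₁‖ = r := by simpa [dist_eq_norm] using hx
    have hxK : x ∈ K := hsub (Metric.sphere_subset_closedBall hx)
    have h2 := Hu (x, s) ⟨hxK, hs.1, by simp; linarith [hs.2]⟩ (x, t) ⟨hxK, le_rfl, by simp⟩ (by
      rw [Prod.dist_eq]
      simp only [dist_self]
      rw [max_lt_iff]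
      refine ⟨hd3, ?_⟩
      rw [Real.dist_eq, abs_of_nonneg (by linarith [hs.1])]
      linarith [hs.2])
    rw [Real.dist_eq] at h2
    have h3 := hch s hs
    simp only [h1]
    have := (abs_lt.1 h2).1
    have := (abs_le.1 h3).2
    simp only at *
    linarith
  · intro s hs
    have hs0 : 0 < s := ht.trans hs.1
    exact (hu_space s hs0).add ((hu_space t ht).neg.add (contDiff_quad δ _ x₁))
  · intro x s hs
    have hs0 : 0 < s := ht.trans hs.1
    apply (hu_time x s hs0).add
    fun_prop
  · intro x hx s hs
    have hs0 : 0 < s := ht.trans hs.1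
    have hxK : x ∈ K := hsub hx
    have hdx : dist x x₁ ≤ r := hx
    rw [laplacian_add (hu_space s hs0) ((hu_space t ht).neg.add (contDiff_quad δ _ x₁)),
      laplacian_add (hu_space t ht).neg (contDiff_quad δ _ x₁), laplacian_quad, laplacian_neg]
    have hd : HasDerivAt (fun s : ℝ => - u x t + (δ * ‖x - x₁‖ ^ 2 + (- (c * (s - t)))))
          (-c) s := by
      have := ((((hasDerivAt_id s).sub_const t).const_mul c).neg.const_add (δ * ‖x - x₁‖ ^ 2)).const_add (- u x t)
      simpa using this
    rw [((hu_time x s hs0).hasDerivAt.fun_add hd).deriv]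
    have e1 := hpde x s hs0
    have e2 := Hl x hxK x₁ hx₁K (by linarith)
    have e3 := Hf (x, s) ⟨hxK, hs.1.le, by simp; linarith [hs.2]⟩ (x₁, t) ⟨hx₁K, le_rfl, by simp⟩ (by
      rw [Prod.dist_eq, max_lt_iff]
      refine ⟨by simp only; linarith, ?_⟩
      simp only
      rw [Real.dist_eq, abs_of_nonneg (by linarith [hs.1])]
      linarith [hs.2])
    rw [Real.dist_eq] at e2 e3
    have e2' := (abs_lt.1 e2).1
    have e3' := (abs_lt.1 e3).1
    simp only at e3'
    linarith

lemma hasDerivAt_posPart_pow (k : ℕ) (x : ℝ) :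
    HasDerivAt (fun x : ℝ => (max 0 x) ^ (k + 2)) ((k + 2) * (max 0 x) ^ (k + 1)) x := by
  rcases lt_trichotomy x 0 with h | h | h
  · have h1 : (fun x : ℝ => (max 0 x) ^ (k + 2)) =ᶠ[nhds x] fun _ => 0 := by
      filter_upwards [Iio_mem_nhds h] with y hy
      rw [max_eq_left (le_of_lt hy)]; simp
    rw [max_eq_left h.le]
    simpa using (hasDerivAt_const x (0:ℝ)).congr_of_eventuallyEq h1
  · subst h
    rw [hasDerivAt_iff_isLittleO]
    simp only [max_self, sub_zero]
    have h1 : (fun x : ℝ => x ^ (k + 2)) =o[nhds 0] fun x => x := by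
      have := Asymptotics.isLittleO_pow_id (𝕜 := ℝ) (n := k + 2) (by omega)
      simpa using this
    refine Asymptotics.IsBigO.trans_isLittleO ?_ h1
    apply Asymptotics.IsBigO.of_bound 1
    filter_upwards with y
    simp only [norm_pow, Real.norm_eq_abs, one_mul]
    simp
    rcases le_total 0 y with h | h
    · rw [max_eq_right h, abs_of_nonneg h]
    · rw [max_eq_left h]; simp
  · have h1 : (fun x : ℝ => (max 0 x) ^ (k + 2)) =ᶠ[nhds x] fun x => x ^ (k + 2) := by
      filter_upwards [Ioi_mem_nhds h] with y hy
      rw [max_eq_right (le_of_lt hy)]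
    rw [max_eq_right h.le]
    have := (hasDerivAt_pow (k + 2) x).congr_of_eventuallyEq h1
    have e : ((k + 2 : ℕ) : ℝ) * x ^ (k + 2 - 1) = (k + 2) * x ^ (k + 1) := by
      push_cast
      rfl
    rw [e] at this
    exact this

lemma hasDerivAt_posPart_pow_two (x : ℝ) :
    HasDerivAt (fun x : ℝ => (max 0 x) ^ 2) (2 * (max 0 x)) x := by
  have := hasDerivAt_posPart_pow 0 x
  norm_num at this
  exact this

lemma hasDerivAt_posPart_pow_three (x : ℝ) :
    HasDerivAt (fun x : ℝ => (max 0 x) ^ 3) (3 * (max 0 x) ^ 2) x := by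
  have := hasDerivAt_posPart_pow 1 x
  norm_num at this
  exact this

/-- the positive part of `1 - |x - x₀|² / R²` -/
noncomputable def wcut {n : ℕ} (x₀ : EuclideanSpace ℝ (Fin n)) (R : ℝ)
    (x : EuclideanSpace ℝ (Fin n)) : ℝ := max 0 (1 - ‖x - x₀‖ ^ 2 * (R ^ 2)⁻¹)

lemma wcut_nonneg {n : ℕ} (x₀ : EuclideanSpace ℝ (Fin n)) (R : ℝ)
    (x : EuclideanSpace ℝ (Fin n)) : 0 ≤ wcut x₀ R x := le_max_left _ _

lemma wcut_le_one {n : ℕ} (x₀ : EuclideanSpace ℝ (Fin n)) (R : ℝ)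
    (x : EuclideanSpace ℝ (Fin n)) : wcut x₀ R x ≤ 1 := by
  apply max_le (by norm_num)
  have : 0 ≤ ‖x - x₀‖ ^ 2 * (R ^ 2)⁻¹ := by positivity
  linarith

lemma wcut_continuous {n : ℕ} (x₀ : EuclideanSpace ℝ (Fin n)) (R : ℝ) :
    Continuous (wcut x₀ R) := by
  unfold wcut
  fun_prop

lemma wcut_eq_zero {n : ℕ} (x₀ : EuclideanSpace ℝ (Fin n)) {R : ℝ} (hR : 0 < R)
    {x : EuclideanSpace ℝ (Fin n)} (hx : x ∉ Metric.closedBall x₀ R) : wcut x₀ R x = 0 := by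
  apply max_eq_left
  have h1 : R < ‖x - x₀‖ := by simpa [dist_eq_norm] using hx
  have h2 : 1 ≤ ‖x - x₀‖ ^ 2 * (R ^ 2)⁻¹ := by
    rw [← div_eq_mul_inv, le_div_iff₀ (by positivity)]
    nlinarith
  linarith

lemma wcut_pos {n : ℕ} (x₀ : EuclideanSpace ℝ (Fin n)) {R : ℝ} (hR : 0 < R)
    {x : EuclideanSpace ℝ (Fin n)} (hx : x ∈ Metric.ball x₀ R) : 0 < wcut x₀ R x := by
  apply lt_max_of_lt_right
  have h1 : ‖x - x₀‖ < R := by simpa [dist_eq_norm] using hx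
  have h2 : ‖x - x₀‖ ^ 2 * (R ^ 2)⁻¹ < 1 := by
    rw [← div_eq_mul_inv, div_lt_one (by positivity)]
    have := norm_nonneg (x - x₀)
    nlinarith
  linarith

lemma wcut_mono {n : ℕ} (x₀ : EuclideanSpace ℝ (Fin n)) {R R' : ℝ} (hR : 0 < R) (hRR : R ≤ R')
    (x : EuclideanSpace ℝ (Fin n)) : wcut x₀ R x ≤ wcut x₀ R' x := by
  unfold wcut
  gcongr

lemma hasFDerivAt_coord {n : ℕ} (i : Fin n) (x₀ x : EuclideanSpace ℝ (Fin n)) :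
    HasFDerivAt (fun y : EuclideanSpace ℝ (Fin n) => y i - x₀ i)
      (EuclideanSpace.proj i : EuclideanSpace ℝ (Fin n) →L[ℝ] ℝ) x :=
  ((EuclideanSpace.proj i : EuclideanSpace ℝ (Fin n) →L[ℝ] ℝ).hasFDerivAt).sub_const _

lemma hasFDerivAt_inner_cut {n : ℕ} (x₀ : EuclideanSpace ℝ (Fin n)) (R : ℝ)
    (x : EuclideanSpace ℝ (Fin n)) :
    HasFDerivAt (fun y : EuclideanSpace ℝ (Fin n) => 1 - ‖y - x₀‖ ^ 2 * (R ^ 2)⁻¹)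
      (-((R ^ 2)⁻¹ • (2 • (innerSL ℝ (x - x₀))))) x :=
  ((hasFDerivAt_normsq x₀ x).mul_const _).const_sub _

lemma hasFDerivAt_wcut_three {n : ℕ} (x₀ : EuclideanSpace ℝ (Fin n)) (R : ℝ)
    (x : EuclideanSpace ℝ (Fin n)) :
    HasFDerivAt (fun y => wcut x₀ R y ^ 3)
      ((3 * wcut x₀ R x ^ 2) • (-((R ^ 2)⁻¹ • (2 • (innerSL ℝ (x - x₀)))) :
        EuclideanSpace ℝ (Fin n) →L[ℝ] ℝ)) x :=
  (hasDerivAt_posPart_pow_three _).comp_hasFDerivAt x (hasFDerivAt_inner_cut x₀ R x)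

lemma hasFDerivAt_wcut_two {n : ℕ} (x₀ : EuclideanSpace ℝ (Fin n)) (R : ℝ)
    (x : EuclideanSpace ℝ (Fin n)) :
    HasFDerivAt (fun y => wcut x₀ R y ^ 2)
      ((2 * wcut x₀ R x) • (-((R ^ 2)⁻¹ • (2 • (innerSL ℝ (x - x₀)))) :
        EuclideanSpace ℝ (Fin n) →L[ℝ] ℝ)) x :=
  (hasDerivAt_posPart_pow_two _).comp_hasFDerivAt x (hasFDerivAt_inner_cut x₀ R x)

lemma fderiv_wcut_three {n : ℕ} (x₀ : EuclideanSpace ℝ (Fin n)) (R : ℝ) (i : Fin n)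
    (x : EuclideanSpace ℝ (Fin n)) :
    fderiv ℝ (fun y => wcut x₀ R y ^ 3) x (EuclideanSpace.single i 1) =
      wcut x₀ R x ^ 2 * ((x i - x₀ i) * (-6 * (R ^ 2)⁻¹)) := by
  rw [(hasFDerivAt_wcut_three x₀ R x).fderiv]
  simp [EuclideanSpace.inner_single_right]
  ring

lemma fderiv_dwcut {n : ℕ} (x₀ : EuclideanSpace ℝ (Fin n)) (R : ℝ) (i : Fin n)
    (x : EuclideanSpace ℝ (Fin n)) :
    fderiv ℝ (fun y => wcut x₀ R y ^ 2 * ((y i - x₀ i) * (-6 * (R ^ 2)⁻¹))) x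
      (EuclideanSpace.single i 1) =
      24 * wcut x₀ R x * (x i - x₀ i) ^ 2 * (R ^ 2)⁻¹ ^ 2 - 6 * wcut x₀ R x ^ 2 * (R ^ 2)⁻¹ := by
  have h := ((hasFDerivAt_wcut_two x₀ R x).fun_mul ((hasFDerivAt_coord i x₀ x).mul_const (-6 * (R ^ 2)⁻¹))).fderiv
  rw [h]
  simp [EuclideanSpace.inner_single_right]
  ring

lemma integrable_of_wcut {n : ℕ} (x₀ : EuclideanSpace ℝ (Fin n)) {R : ℝ} (hR : 0 < R)
    {g : EuclideanSpace ℝ (Fin n) → ℝ} (hg : Continuous g)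
    (hz : ∀ x, wcut x₀ R x = 0 → g x = 0) : Integrable g := by
  apply hg.integrable_of_hasCompactSupport
  apply HasCompactSupport.intro (isCompact_closedBall x₀ R)
  intro x hx
  exact hz x (wcut_eq_zero x₀ hR hx)

lemma ibp_coord {n : ℕ} (x₀ : EuclideanSpace ℝ (Fin n)) {R : ℝ} (hR : 0 < R)
    {v : EuclideanSpace ℝ (Fin n) → ℝ} (hv : ContDiff ℝ 2 v) (i : Fin n) :
    ∫ x, wcut x₀ R x ^ 3 * fderiv ℝ (fun y => fderiv ℝ v y (EuclideanSpace.single i 1)) x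
        (EuclideanSpace.single i 1) =
      ∫ x, (24 * wcut x₀ R x * (x i - x₀ i) ^ 2 * (R ^ 2)⁻¹ ^ 2 -
        6 * wcut x₀ R x ^ 2 * (R ^ 2)⁻¹) * v x := by
  have hw := wcut_continuous x₀ R
  have hv1 := differentiable_fderiv_apply hv (EuclideanSpace.single i 1)
  have hv0c := hv.continuous
  have hv1c := hv1.continuous
  have hv2c : Continuous (fun x => fderiv ℝ (fun y => fderiv ℝ v y (EuclideanSpace.single i 1)) x
        (EuclideanSpace.single i 1)) :=
    (hv1.continuous_fderiv (by norm_num)).clm_apply continuous_const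
  have hci : Continuous fun x : EuclideanSpace ℝ (Fin n) => x i := by fun_prop
  rw [integral_mul_fderiv_eq_neg_fderiv_mul_of_integrable]
  rotate_left
  · simp_rw [fderiv_wcut_three]
    apply integrable_of_wcut x₀ hR (by fun_prop)
    intro x hx; simp [hx]
  · apply integrable_of_wcut x₀ hR (by fun_prop)
    intro x hx; simp [hx]
  · apply integrable_of_wcut x₀ hR (by fun_prop)
    intro x hx; simp [hx]
  · intro x _
    exact (hasFDerivAt_wcut_three x₀ R x).differentiableAt
  · intro x _
    exact hv1.differentiable (by norm_num) x
  simp_rw [fderiv_wcut_three]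
  rw [integral_mul_fderiv_eq_neg_fderiv_mul_of_integrable, neg_neg]
  · simp_rw [fderiv_dwcut]
  · simp_rw [fderiv_dwcut]
    apply integrable_of_wcut x₀ hR (by fun_prop)
    intro x hx; simp [hx]
  · apply integrable_of_wcut x₀ hR (by fun_prop)
    intro x hx; simp [hx]
  · apply integrable_of_wcut x₀ hR (by fun_prop)
    intro x hx; simp [hx]
  · intro x _
    exact ((hasFDerivAt_wcut_two x₀ R x).fun_mul ((hasFDerivAt_coord i x₀ x).mul_const (-6 * (R ^ 2)⁻¹))).differentiableAt
  · intro x _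
    exact hv.differentiable (by norm_num) x

lemma setIntegral_wcut {n : ℕ} (x₀ : EuclideanSpace ℝ (Fin n)) {R : ℝ} (hR : 0 < R)
    {g : EuclideanSpace ℝ (Fin n) → ℝ} 
    (hz : ∀ x, wcut x₀ R x = 0 → g x = 0) : ∫ x in Metric.closedBall x₀ R, g x = ∫ x, g x := by
  apply setIntegral_eq_integral_of_forall_compl_eq_zero
  intro x hx
  exact hz x (wcut_eq_zero x₀ hR hx)

/-- the constant in the differential inequality of the cutoff -/
noncomputable def Lc (n : ℕ) : ℝ := (6 * n + 24) ^ 2 / 96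

lemma Lc_nonneg (n : ℕ) : 0 ≤ Lc n := by unfold Lc; positivity

lemma ibp_lower {n : ℕ} (x₀ : EuclideanSpace ℝ (Fin n)) {R : ℝ} (hR : 0 < R)
    {v : EuclideanSpace ℝ (Fin n) → ℝ} (hv : ContDiff ℝ 2 v) (hv0 : ∀ x, 0 ≤ v x) :
    -(Lc n * (R ^ 2)⁻¹) * ∫ x in Metric.closedBall x₀ R, v x * wcut x₀ R x ^ 3 ≤
      ∫ x in Metric.closedBall x₀ R, laplacian v x * wcut x₀ R x ^ 3 := by
  have hw := wcut_continuous x₀ R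
  have hv0c := hv.continuous
  rw [setIntegral_wcut x₀ hR (by intro x hx; simp [hx]),
    setIntegral_wcut x₀ hR (by intro x hx; simp [hx])]
  have h1 : ∫ x, laplacian v x * wcut x₀ R x ^ 3 =
      ∑ i, ∫ x, (24 * wcut x₀ R x * (x i - x₀ i) ^ 2 * (R ^ 2)⁻¹ ^ 2 -
        6 * wcut x₀ R x ^ 2 * (R ^ 2)⁻¹) * v x := by
    simp_rw [← ibp_coord x₀ hR hv]
    rw [← integral_finsetSum]
    · congr 1; funext x
      unfold laplacian
      rw [Finset.sum_mul]
      apply Finset.sum_congr rfl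
      intro i _
      ring
    · intro i _
      have hv1 := differentiable_fderiv_apply hv (EuclideanSpace.single i 1)
      have hv2c : Continuous (fun x => fderiv ℝ (fun y => fderiv ℝ v y (EuclideanSpace.single i 1)) x
        (EuclideanSpace.single i 1)) :=
        (hv1.continuous_fderiv (by norm_num)).clm_apply continuous_const
      apply integrable_of_wcut x₀ hR (by fun_prop)
      intro x hx; simp [hx]
  have hIntg : ∀ i : Fin n, Integrable fun x => (24 * wcut x₀ R x * (x i - x₀ i) ^ 2 * (R ^ 2)⁻¹ ^ 2 -
        6 * wcut x₀ R x ^ 2 * (R ^ 2)⁻¹) * v x := by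
    intro i
    apply integrable_of_wcut x₀ hR (by fun_prop)
    intro x hx; simp [hx]
  rw [h1, ← integral_finsetSum _ (fun i _ => hIntg i), ← integral_const_mul]
  apply integral_mono
  · apply integrable_of_wcut x₀ hR (by fun_prop)
    intro x hx; simp [hx]
  · exact integrable_finsetSum _ (fun i _ => hIntg i)
  intro x
  simp only
  rw [← Finset.sum_mul]
  have h2 : ∑ i : Fin n, (x i - x₀ i) ^ 2 = ‖x - x₀‖ ^ 2 := by
    rw [EuclideanSpace.norm_sq_eq]
    simp
  have h3 : ∑ i : Fin n, (24 * wcut x₀ R x * (x i - x₀ i) ^ 2 * (R ^ 2)⁻¹ ^ 2 -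
        6 * wcut x₀ R x ^ 2 * (R ^ 2)⁻¹) = 24 * wcut x₀ R x * ‖x - x₀‖ ^ 2 * (R ^ 2)⁻¹ ^ 2 -
        n * (6 * wcut x₀ R x ^ 2 * (R ^ 2)⁻¹) := by
    rw [Finset.sum_sub_distrib, ← h2, Finset.mul_sum, Finset.sum_mul]
    simp
  rw [h3]
  have h4 : wcut x₀ R x * (‖x - x₀‖ ^ 2 * (R ^ 2)⁻¹) = wcut x₀ R x * (1 - wcut x₀ R x) := by
    unfold wcut
    rcases le_total 0 (1 - ‖x - x₀‖ ^ 2 * (R ^ 2)⁻¹) with h | h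
    · rw [max_eq_right h]; ring
    · rw [max_eq_left h]; ring
  have h5 : 24 * wcut x₀ R x * ‖x - x₀‖ ^ 2 * (R ^ 2)⁻¹ ^ 2 =
      24 * (R ^ 2)⁻¹ * (wcut x₀ R x * (1 - wcut x₀ R x)) := by rw [← h4]; ring
  rw [h5]
  have hw0 := wcut_nonneg x₀ R x
  set w := wcut x₀ R x
  have hq : 0 ≤ Lc n * w ^ 2 - (6 * n + 24) * w + 24 := by
    have : Lc n * w ^ 2 - (6 * n + 24) * w + 24 = 24 * (1 - (6 * n + 24) * w / 48) ^ 2 := by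
      unfold Lc; ring
    rw [this]; positivity
  have hRi : 0 ≤ (R ^ 2)⁻¹ := by positivity
  have := mul_nonneg (mul_nonneg (mul_nonneg hRi hw0) hq) (hv0 x)
  nlinarith [this]

lemma continuousOn_ballIntegral {n : ℕ} (g : EuclideanSpace ℝ (Fin n) → ℝ → ℝ)
    (hg : ContinuousOn (fun q : EuclideanSpace ℝ (Fin n) × ℝ => g q.1 q.2)
      {q : EuclideanSpace ℝ (Fin n) × ℝ | 0 < q.2})
    (x₀ : EuclideanSpace ℝ (Fin n)) (R : ℝ) :
    ContinuousOn (fun t => ∫ x in Metric.closedBall x₀ R, g x t) (Ioi 0) := by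
  rw [continuousOn_iff_continuous_domRestrict]
  have : LocallyCompactSpace (Ioi (0:ℝ)) := isOpen_Ioi.locallyCompactSpace
  have := continuous_parametric_integral_of_continuous (μ := (volume : Measure (EuclideanSpace ℝ (Fin n))))
    (f := fun (t : Ioi (0:ℝ)) (x : EuclideanSpace ℝ (Fin n)) => g x t)
    (s := Metric.closedBall x₀ R) ?_ (isCompact_closedBall x₀ R)
  · exact this
  · have h2 : Continuous (fun q : (Ioi (0:ℝ)) × EuclideanSpace ℝ (Fin n) => ((q.2, (q.1 : ℝ)) : EuclideanSpace ℝ (Fin n) × ℝ)) := by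
      fun_prop
    exact hg.comp_continuous h2 (fun q => q.1.2)

lemma continuous_slice {n : ℕ} {g : EuclideanSpace ℝ (Fin n) → ℝ → ℝ}
    (hg : ContinuousOn (fun q : EuclideanSpace ℝ (Fin n) × ℝ => g q.1 q.2)
      {q : EuclideanSpace ℝ (Fin n) × ℝ | 0 < q.2}) {t : ℝ} (ht : 0 < t) :
    Continuous (fun x => g x t) :=
  hg.comp_continuous (f := fun x => (x, t)) (by fun_prop) (fun _ => ht)

lemma integrableOn_closedBall {n : ℕ} {g : EuclideanSpace ℝ (Fin n) → ℝ} (hg : Continuous g)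
    (x₀ : EuclideanSpace ℝ (Fin n)) (R : ℝ) : IntegrableOn g (Metric.closedBall x₀ R) :=
  hg.continuousOn.integrableOn_compact (isCompact_closedBall x₀ R)

lemma dini_F {n : ℕ} (u f : EuclideanSpace ℝ (Fin n) → ℝ → ℝ)
    (hu_cont : ContinuousOn (fun q : EuclideanSpace ℝ (Fin n) × ℝ => u q.1 q.2)
      {q : EuclideanSpace ℝ (Fin n) × ℝ | 0 < q.2})
    (hu_space : ∀ t : ℝ, 0 < t → ContDiff ℝ 2 (fun x => u x t))
    (hu_time : ∀ x, ∀ t : ℝ, 0 < t → DifferentiableAt ℝ (fun s => u x s) t)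
    (hf_cont : ContinuousOn (fun q : EuclideanSpace ℝ (Fin n) × ℝ => f q.1 q.2)
      {q : EuclideanSpace ℝ (Fin n) × ℝ | 0 < q.2})
    (hpde : ∀ x, ∀ t : ℝ, 0 < t →
      laplacian (fun y => u y t) x + f x t ≤ deriv (fun s => u x s) t)
    (hu0 : ∀ x, ∀ t : ℝ, 0 < t → 0 ≤ u x t)
    (x₀ : EuclideanSpace ℝ (Fin n)) (R t ε : ℝ) (hR : 0 < R) (ht : 0 < t) (hε : 0 < ε) :
    ∃ h₀ > 0, ∀ h ∈ Ioo 0 h₀,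
      (∫ x in Metric.closedBall x₀ R, u x t * wcut x₀ R x ^ 3) +
        h * (-(Lc n * (R ^ 2)⁻¹) * (∫ x in Metric.closedBall x₀ R, u x t * wcut x₀ R x ^ 3) +
          (∫ x in Metric.closedBall x₀ R, f x t * wcut x₀ R x ^ 3) - ε) ≤
      ∫ x in Metric.closedBall x₀ R, u x (t + h) * wcut x₀ R x ^ 3 := by
  have hw := wcut_continuous x₀ R
  set I := ∫ x in Metric.closedBall x₀ R, wcut x₀ R x ^ 3 with hI
  have hI0 : 0 ≤ I := integral_nonneg fun x => pow_nonneg (wcut_nonneg x₀ R x) 3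
  obtain ⟨h₀, hh₀, H⟩ := forward_quotient u f hu_cont hu_space hu_time hf_cont hpde x₀ R t
    (ε / (I + 1)) ht (by positivity)
  refine ⟨h₀, hh₀, ?_⟩
  intro h hh
  have hu := (hu_space t ht).continuous
  have hu' := (hu_space (t + h) (by linarith [hh.1])).continuous
  have hl := continuous_laplacian (hu_space t ht)
  have hf := continuous_slice hf_cont ht
  have h1 : ∫ x in Metric.closedBall x₀ R, (u x t * wcut x₀ R x ^ 3 +
      h * (laplacian (fun y => u y t) x * wcut x₀ R x ^ 3 + f x t * wcut x₀ R x ^ 3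
        - ε / (I + 1) * wcut x₀ R x ^ 3)) ≤
      ∫ x in Metric.closedBall x₀ R, u x (t + h) * wcut x₀ R x ^ 3 := by
    apply setIntegral_mono_on
    · exact integrableOn_closedBall (by fun_prop) _ _
    · exact integrableOn_closedBall (by fun_prop) _ _
    · exact measurableSet_closedBall
    · intro x hx
      have := mul_le_mul_of_nonneg_right (H h hh x hx) (pow_nonneg (wcut_nonneg x₀ R x) 3)
      linarith
  have i1 : IntegrableOn (fun x => u x t * wcut x₀ R x ^ 3) (Metric.closedBall x₀ R) :=
    integrableOn_closedBall (by fun_prop) _ _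
  have i2 : IntegrableOn (fun x => laplacian (fun y => u y t) x * wcut x₀ R x ^ 3) (Metric.closedBall x₀ R) :=
    integrableOn_closedBall (by fun_prop) _ _
  have i3 : IntegrableOn (fun x => f x t * wcut x₀ R x ^ 3) (Metric.closedBall x₀ R) :=
    integrableOn_closedBall (by fun_prop) _ _
  have i4 : IntegrableOn (fun x => ε / (I + 1) * wcut x₀ R x ^ 3) (Metric.closedBall x₀ R) :=
    integrableOn_closedBall (by fun_prop) _ _
  have i5 : IntegrableOn (fun x => laplacian (fun y => u y t) x * wcut x₀ R x ^ 3 +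
      f x t * wcut x₀ R x ^ 3) (Metric.closedBall x₀ R) :=
    integrableOn_closedBall (by fun_prop) _ _
  have i6 : IntegrableOn (fun x => h * (laplacian (fun y => u y t) x * wcut x₀ R x ^ 3 +
      f x t * wcut x₀ R x ^ 3 - ε / (I + 1) * wcut x₀ R x ^ 3)) (Metric.closedBall x₀ R) :=
    integrableOn_closedBall (by fun_prop) _ _
  rw [integral_add i1 i6, integral_const_mul,
    integral_sub i5 i4, integral_add i2 i3, integral_const_mul] at h1
  refine le_trans ?_ h1
  have h2 := ibp_lower x₀ hR (hu_space t ht) (fun x => hu0 x t ht)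
  have h3 : ε / (I + 1) * I ≤ ε := by
    rw [div_mul_eq_mul_div, div_le_iff₀ (by positivity)]
    nlinarith
  have := hh.1
  gcongr

open Topology Filter in
lemma time_lemma (F J θ θ' : ℝ → ℝ) (κ a b : ℝ) (ha : 0 < a) (hab : a ≤ b)
    (hF : ContinuousOn F (Ioi 0)) (hJ : ContinuousOn J (Ioi 0))
    (hdini : ∀ t, 0 < t → ∀ ε, 0 < ε → ∃ h₀ > 0, ∀ h ∈ Ioo 0 h₀,
      F t + h * (-κ * F t + J t - ε) ≤ F (t + h))
    (hθ : ∀ t ∈ Icc a b, HasDerivAt θ (θ' t) t) (hθ' : ContinuousOn θ' (Icc a b))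
    (hθ0 : ∀ t ∈ Icc a b, 0 ≤ θ t) :
    θ a * F a + ∫ t in a..b, (θ' t * F t + θ t * (-κ * F t + J t)) ≤ θ b * F b := by
  have hsub : Icc a b ⊆ Ioi 0 := fun t ht => lt_of_lt_of_le ha ht.1
  have hFc := hF.mono hsub
  have hJc := hJ.mono hsub
  have hθc : ContinuousOn θ (Icc a b) := fun t ht => (hθ t ht).continuousAt.continuousWithinAt
  set G : ℝ → ℝ := fun t => θ' t * F t + θ t * (-κ * F t + J t) with hG
  have hGc : ContinuousOn G (Icc a b) := by fun_prop
  have hGi : ∀ x ∈ Icc a b, IntervalIntegrable G volume a x := by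
    intro x hx
    apply ContinuousOn.intervalIntegrable
    rw [uIcc_of_le hx.1]
    exact hGc.mono (Icc_subset_Icc_right hx.2)
  have key := image_le_of_liminf_slope_right_le_deriv_boundary (f := fun t => -(θ t * F t))
    (B := fun t => -(θ a * F a) + -(∫ s in a..t, G s)) (B' := fun t => - G t) (a := a) (b := b)
    (by fun_prop) (by simp) ?_ ?_ ?_ ⟨hab, le_rfl⟩
  · linarith
  · apply ContinuousOn.add continuousOn_const
    apply ContinuousOn.neg
    have := intervalIntegral.continuousOn_primitive_interval (a := a) (b := b) (f := G) (μ := volume)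
      (by rw [uIcc_of_le hab]; exact hGc.integrableOn_Icc)
    rwa [uIcc_of_le hab] at this
  · intro x hx
    have h1 : HasDerivWithinAt (fun t => ∫ s in a..t, G s) (G x) (Ici x) x := by
      have hnb : Icc a b ∈ 𝓝[>] x := by
        filter_upwards [Ioo_mem_nhdsGT hx.2] with y hy using ⟨hx.1.trans hy.1.le, hy.2.le⟩
      apply intervalIntegral.integral_hasDerivWithinAt_right (hGi x ⟨hx.1, hx.2.le⟩) (t := Ioi x)
      · exact ⟨Icc a b, hnb, hGc.aestronglyMeasurable measurableSet_Icc⟩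
      · exact (hGc x ⟨hx.1, hx.2.le⟩).mono_of_mem_nhdsWithin hnb
    exact h1.neg.const_add _
  · intro x hx r hr
    apply Eventually.frequently
    have hx' : x ∈ Icc a b := ⟨hx.1, hx.2.le⟩
    have hx0 : 0 < x := hsub hx'
    -- choose ε
    have hθx := hθ0 x hx'
    obtain ⟨ε, hε, hεr⟩ : ∃ ε > 0, - G x + θ x * ε < r := by
      refine ⟨(r + G x) / (2 * (θ x + 1)), by apply div_pos <;> linarith, ?_⟩
      have : θ x * ((r + G x) / (2 * (θ x + 1))) ≤ (r + G x) / 2 := by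
        rw [mul_div_assoc', div_le_div_iff₀ (by positivity) (by norm_num)]
        have : 0 < r + G x := by linarith
        nlinarith
      linarith
    obtain ⟨h₀, hh₀, H⟩ := hdini x hx0 ε hε
    have hsl : Tendsto (slope θ x) (𝓝[>] x) (𝓝 (θ' x)) := by
      have := (hθ x hx').hasDerivWithinAt (s := Ioi x)
      rwa [hasDerivWithinAt_iff_tendsto_slope' (by simp)] at this
    have hθt : Tendsto θ (𝓝[>] x) (𝓝 (θ x)) := (hθ x hx').continuousAt.tendsto.mono_left nhdsWithin_le_nhds
    have hlim : Tendsto (fun z => -(θ z * (-κ * F x + J x - ε)) - F x * slope θ x z) (𝓝[>] x)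
        (𝓝 (-(θ x * (-κ * F x + J x - ε)) - F x * θ' x)) :=
      ((hθt.mul_const _).neg).sub (hsl.const_mul _)
    have hev := hlim.eventually_lt_const (u := r) (by simp only [hG] at hεr; linarith)
    filter_upwards [hev, Ioo_mem_nhdsGT hx.2, Ioo_mem_nhdsGT (show x < x + h₀ by linarith)] with z h1 h2 h3
    refine lt_of_le_of_lt ?_ h1
    have hz := H (z - x) ⟨by linarith [h3.1], by linarith [h3.2]⟩
    rw [add_sub_cancel] at hz
    have hzx : 0 < z - x := by linarith [h3.1]
    have hθz := hθ0 z ⟨hx.1.trans h2.1.le, h2.2.le⟩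
    rw [slope_def_field, slope_def_field, div_le_iff₀ hzx, sub_mul]
    have e : F x * ((θ z - θ x) / (z - x)) * (z - x) = F x * (θ z - θ x) := by
      field_simp
    rw [e]
    have := mul_le_mul_of_nonneg_left hz hθz
    linarith

lemma young_pointwise {p u V y l m : ℝ} (hp : 1 < p) (hu : 0 ≤ u) (hV : 0 < V) (hy : 0 ≤ y)
    (hl : 0 < l) (hm : 0 ≤ m) :
    m * y ^ (p / (p - 1) - 1) * u ≤
      l * (y ^ (p / (p - 1)) * (|u| ^ p * V)) +
        l ^ (-(1 / (p - 1))) * (m ^ (p / (p - 1)) * V ^ (-(1 / (p - 1)))) := by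
  have hp1 : 0 < p - 1 := by linarith
  have hp0 : 0 < p := by linarith
  set q := p / (p - 1) with hq
  have hpq : p.HolderConjugate q := Real.HolderConjugate.conjExponent hp
  have hq1 : 1 ≤ q := hpq.symm.lt.le
  have hW : 0 < l * V := by positivity
  have e1 : (q - 1) * p = q := by rw [hq]; field_simp; ring
  have e2 : -(1 / p) * q = -(1 / (p - 1)) := by rw [hq]; field_simp
  have hyo := Real.young_inequality_of_nonneg (a := y ^ (q - 1) * u * (l * V) ^ (1 / p))
    (b := m * (l * V) ^ (-(1 / p))) (by positivity) (by positivity) hpq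
  have h1 : y ^ (q - 1) * u * (l * V) ^ (1 / p) * (m * (l * V) ^ (-(1 / p))) = m * y ^ (q - 1) * u := by
    have : (l * V) ^ (1 / p) * (l * V) ^ (-(1 / p)) = 1 := by
      rw [← Real.rpow_add hW]; simp
    linear_combination (m * y ^ (q - 1) * u) * this
  have h2 : (y ^ (q - 1) * u * (l * V) ^ (1 / p)) ^ p = l * (y ^ q * (|u| ^ p * V)) := by
    rw [Real.mul_rpow (by positivity) (by positivity), Real.mul_rpow (by positivity) hu,
      ← Real.rpow_mul hy, ← Real.rpow_mul hW.le, e1, abs_of_nonneg hu,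
      one_div_mul_cancel hp0.ne', Real.rpow_one]
    ring
  have h3 : (m * (l * V) ^ (-(1 / p))) ^ q =
      l ^ (-(1 / (p - 1))) * (m ^ q * V ^ (-(1 / (p - 1)))) := by
    rw [Real.mul_rpow hm (by positivity), ← Real.rpow_mul hW.le, e2, Real.mul_rpow hl.le hV.le]
    ring
  rw [h1, h2, h3] at hyo
  refine hyo.trans (add_le_add ?_ ?_)
  · exact div_le_self (by positivity) hp.le
  · exact div_le_self (by positivity) hq1

lemma core_est (F J N : ℝ → ℝ) (R L q a CN ρ : ℝ) (hR : 0 < R) (hL : 0 ≤ L) (hq : 1 ≤ q)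
    (ha : 0 < a) (haR : a ≤ R ^ 2 / 4)
    (hF : ContinuousOn F (Ioi 0)) (hJ : ContinuousOn J (Ioi 0)) (hN : ContinuousOn N (Ioi 0))
    (hF0 : ∀ t, 0 < t → 0 ≤ F t) (hJ0 : ∀ t, 0 < t → 0 ≤ J t) (hN0 : ∀ t, 0 < t → 0 ≤ N t)
    (hdini : ∀ t, 0 < t → ∀ ε, 0 < ε → ∃ h₀ > 0, ∀ h ∈ Ioo 0 h₀,
      F t + h * (-(L * (R ^ 2)⁻¹) * F t + J t - ε) ≤ F (t + h))
    (hY : ∀ t, 0 < t → ∀ y, 0 ≤ y → ∀ l, 0 < l → (R ^ 2)⁻¹ * y ^ (q - 1) * F t ≤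
      l * (y ^ q * J t) + l ^ (-ρ) * (((R ^ 2)⁻¹) ^ q * N t))
    (hCN : ((R ^ 2)⁻¹) ^ q * ∫ t in (R ^ 2 / 4)..(R ^ 2), N t ≤ CN) :
    ∃ X, 0 ≤ X ∧ X ≤ exp L * ∫ t in (R ^ 2 / 4)..(R ^ 2), J t ∧
      ∀ l, 0 < l → (∫ t in a..(R ^ 2 / 4), J t) + X ≤
        4 * q / 3 * (l * X + exp L * (l ^ (-ρ) * CN)) := by
  set m := (R ^ 2)⁻¹ with hm
  have hR2 : 0 < R ^ 2 := by positivity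
  have hm0 : 0 < m := by positivity
  have hmR : R ^ 2 * m = 1 := mul_inv_cancel₀ hR2.ne'
  have hb0 : 0 < R ^ 2 / 4 := by positivity
  have hbR : R ^ 2 / 4 ≤ R ^ 2 := by linarith
  have hsub1 : Icc a (R ^ 2 / 4) ⊆ Ioi 0 := fun t ht => lt_of_lt_of_le ha ht.1
  have hsub2 : Icc (R ^ 2 / 4) (R ^ 2) ⊆ Ioi 0 := fun t ht => lt_of_lt_of_le hb0 ht.1
  have hF2 := hF.mono hsub2
  have hJ2 := hJ.mono hsub2
  have hN2 := hN.mono hsub2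
  have hJ1 := hJ.mono hsub1
  have hF1 := hF.mono hsub1
  set e : ℝ → ℝ := fun t => exp (L * m * t) with he
  have hec : Continuous e := by fun_prop
  have hed : ∀ t, HasDerivAt e (L * m * e t) t := by
    intro t
    have := ((hasDerivAt_id t).const_mul (L * m)).exp
    simp only [id, mul_one] at this
    rw [mul_comm]
    exact this
  have he1 : ∀ t, 0 ≤ t → 1 ≤ e t := by
    intro t ht
    exact Real.one_le_exp (by positivity)
  have heL : ∀ t, t ≤ R ^ 2 → e t ≤ exp L := by
    intro t ht
    apply Real.exp_le_exp.2
    calc L * m * t ≤ L * m * R ^ 2 := by gcongr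
      _ = L := by rw [mul_assoc, mul_comm m, hmR, mul_one]
  have he0 : ∀ t, 0 ≤ e t := fun t => (Real.exp_pos _).le
  -- first interval
  have I1 := time_lemma F J e (fun t => L * m * e t) (L * m) a (R ^ 2 / 4) ha haR hF hJ hdini
    (fun t _ => hed t) (by fun_prop) (fun t _ => he0 t)
  have I1' : ∫ t in a..(R ^ 2 / 4), J t ≤ ∫ t in a..(R ^ 2 / 4),
      (L * m * e t * F t + e t * (-(L * m) * F t + J t)) := by
    apply intervalIntegral.integral_mono_on haR
    · apply ContinuousOn.intervalIntegrable
      rwa [uIcc_of_le haR]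
    · apply ContinuousOn.intervalIntegrable
      rw [uIcc_of_le haR]
      fun_prop
    · intro t ht
      have ht0 : 0 < t := hsub1 ht
      have := mul_le_mul_of_nonneg_right (he1 t ht0.le) (hJ0 t ht0)
      linarith
  -- second interval
  set y : ℝ → ℝ := fun t => 4 / 3 * (1 - t * m) with hy
  have hyc : Continuous y := by fun_prop
  have hyd : ∀ t, HasDerivAt y (-(4 / 3 * m)) t := by
    intro t
    have := (((hasDerivAt_id t).mul_const m).const_sub 1).const_mul (4 / 3)
    simp only [id] at this
    have e' : (4 / 3 : ℝ) * -(1 * m) = -(4 / 3 * m) := by ring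
    rw [e'] at this
    exact this
  have hy0 : ∀ t ∈ Icc (R ^ 2 / 4) (R ^ 2), 0 ≤ y t := by
    intro t ht
    have : t * m ≤ 1 := by rw [← hmR]; gcongr; exact ht.2
    simp only [hy]; linarith
  have hy1 : ∀ t ∈ Icc (R ^ 2 / 4) (R ^ 2), y t ≤ 1 := by
    intro t ht
    have : (R ^ 2 / 4) * m ≤ t * m := by gcongr; exact ht.1
    simp only [hy]; linarith
  have hyqc : Continuous (fun t => y t ^ q) :=
    hyc.rpow_const (fun t => Or.inr (by linarith))
  have hyq1c : Continuous (fun t => y t ^ (q - 1)) :=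
    hyc.rpow_const (fun t => Or.inr (by linarith))
  have hyqd : ∀ t, HasDerivAt (fun t => y t ^ q) (-(4 / 3 * m) * q * y t ^ (q - 1)) t := by
    intro t
    exact (hyd t).rpow_const (Or.inr hq)
  have I2 := time_lemma F J (fun t => e t * y t ^ q)
    (fun t => L * m * e t * y t ^ q + e t * (-(4 / 3 * m) * q * y t ^ (q - 1))) (L * m)
    (R ^ 2 / 4) (R ^ 2) hb0 hbR hF hJ hdini
    (fun t _ => (hed t).fun_mul (hyqd t)) (by fun_prop)
    (fun t ht => mul_nonneg (he0 t) (Real.rpow_nonneg (hy0 t ht) _))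
  have hyb : y (R ^ 2 / 4) = 1 := by
    simp only [hy]; linear_combination (-1 / 3) * hmR
  have hyR : y (R ^ 2) = 0 := by
    simp only [hy]; rw [hmR]; ring
  rw [hyb, hyR, Real.one_rpow, Real.zero_rpow (by linarith)] at I2
  have Icont : ∀ g : ℝ → ℝ, ContinuousOn g (Icc (R ^ 2 / 4) (R ^ 2)) →
      IntervalIntegrable g volume (R ^ 2 / 4) (R ^ 2) := by
    intro g hg
    apply ContinuousOn.intervalIntegrable
    rwa [uIcc_of_le hbR]
  have hP : ContinuousOn (fun t => e t * (y t ^ q * J t)) (Icc (R ^ 2 / 4) (R ^ 2)) :=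
    hec.continuousOn.mul (hyqc.continuousOn.mul hJ2)
  set X := ∫ t in (R ^ 2 / 4)..(R ^ 2), e t * (y t ^ q * J t) with hX
  refine ⟨X, ?_, ?_, ?_⟩
  · apply intervalIntegral.integral_nonneg hbR
    intro t ht
    exact mul_nonneg (he0 t) (mul_nonneg (Real.rpow_nonneg (hy0 t ht) _) (hJ0 t (hsub2 ht)))
  · rw [hX, ← intervalIntegral.integral_const_mul]
    apply intervalIntegral.integral_mono_on hbR
    · exact Icont _ hP
    · exact Icont _ (continuousOn_const.mul hJ2)
    · intro t ht
      have h1 := heL t ht.2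
      have h2 : y t ^ q ≤ 1 := Real.rpow_le_one (hy0 t ht) (hy1 t ht) (by linarith)
      have h3 := hJ0 t (hsub2 ht)
      have h4 : y t ^ q * J t ≤ J t := by nlinarith
      exact mul_le_mul h1 h4 (mul_nonneg (Real.rpow_nonneg (hy0 t ht) _) h3) (Real.exp_pos _).le
  · intro l hl
    have hP2 : ContinuousOn (fun t => l * (e t * (y t ^ q * J t))) (Icc (R ^ 2 / 4) (R ^ 2)) :=
      continuousOn_const.mul hP
    have hN3 : ContinuousOn (fun t => exp L * (l ^ (-ρ) * (m ^ q * N t)))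
        (Icc (R ^ 2 / 4) (R ^ 2)) :=
      continuousOn_const.mul (continuousOn_const.mul (continuousOn_const.mul hN2))
    have hPN : ContinuousOn (fun t => 4 * q / 3 * (l * (e t * (y t ^ q * J t))
        + exp L * (l ^ (-ρ) * (m ^ q * N t)))) (Icc (R ^ 2 / 4) (R ^ 2)) :=
      continuousOn_const.mul (hP2.add hN3)
    have hG : ContinuousOn (fun t => (L * m * e t * y t ^ q + e t * (-(4 / 3 * m) * q * y t ^ (q - 1)))
        * F t + e t * y t ^ q * (-(L * m) * F t + J t)) (Icc (R ^ 2 / 4) (R ^ 2)) := by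
      have c1 : Continuous (fun t => L * m * e t * y t ^ q +
        e t * (-(4 / 3 * m) * q * y t ^ (q - 1))) := by fun_prop
      have c2 : Continuous (fun t => e t * y t ^ q) := hec.mul hyqc
      exact (c1.continuousOn.mul hF2).add (c2.continuousOn.mul ((continuousOn_const.mul hF2).add hJ2))
    have I3 : X - 4 * q / 3 * (l * X + exp L * (l ^ (-ρ) * (m ^ q * ∫ t in (R ^ 2 / 4)..(R ^ 2), N t))) ≤
      ∫ t in (R ^ 2 / 4)..(R ^ 2), ((L * m * e t * y t ^ q + e t * (-(4 / 3 * m) * q * y t ^ (q - 1))) * F t +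
        e t * y t ^ q * (-(L * m) * F t + J t)) := by
      have e1 : X - 4 * q / 3 * (l * X + exp L * (l ^ (-ρ) * (m ^ q * ∫ t in (R ^ 2 / 4)..(R ^ 2), N t))) =
        ∫ t in (R ^ 2 / 4)..(R ^ 2), (e t * (y t ^ q * J t) - 4 * q / 3 * (l * (e t * (y t ^ q * J t))
          + exp L * (l ^ (-ρ) * (m ^ q * N t)))) := by
        rw [intervalIntegral.integral_sub, intervalIntegral.integral_const_mul,
          intervalIntegral.integral_add, intervalIntegral.integral_const_mul,
          intervalIntegral.integral_const_mul, intervalIntegral.integral_const_mul,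
          intervalIntegral.integral_const_mul]
        all_goals first | exact Icont _ hP | exact Icont _ hP2 | exact Icont _ hN3 | exact Icont _ hPN
      rw [e1]
      apply intervalIntegral.integral_mono_on hbR
      · exact Icont _ (hP.sub hPN)
      · exact Icont _ hG
      · intro t ht
        have ht0 : 0 < t := hsub2 ht
        have h1 := mul_le_mul_of_nonneg_left (hY t ht0 (y t) (hy0 t ht) l hl) (he0 t)
        have h2 : 0 ≤ l ^ (-ρ) * (m ^ q * N t) := by
          have := hN0 t ht0
          positivity
        have h3 := mul_le_mul_of_nonneg_right (heL t ht.2) h2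
        have h4 : 0 ≤ 4 * q / 3 := by positivity
        have h5 := mul_le_mul_of_nonneg_left (h1.trans (by linarith :
          _ ≤ l * (e t * (y t ^ q * J t)) + exp L * (l ^ (-ρ) * (m ^ q * N t)))) h4
        linarith
    have h6 : 4 * q / 3 * (l * X + exp L * (l ^ (-ρ) * (m ^ q * ∫ t in (R ^ 2 / 4)..(R ^ 2), N t))) ≤
        4 * q / 3 * (l * X + exp L * (l ^ (-ρ) * CN)) := by
      gcongr
    have h7 := mul_nonneg (he0 a) (hF0 a ha)
    linarith

open Topology Filter in
lemma seq_lemma (s X : ℕ → ℝ) (K B D ρ : ℝ) (hK : 0 < K) (hρ : 0 < ρ)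
    (hX : ∀ k, 0 ≤ X k) (hXs : ∀ k, X k ≤ B * (s (k + 1) - s k)) (hs : Monotone s)
    (h : ∀ k l, 0 < l → s k + X k ≤ K * (l * X k + D * l ^ (-ρ))) : ∀ k, s k ≤ 0 := by
  have hbdd : BddAbove (range s) := by
    refine ⟨K * (D * (1 / K) ^ (-ρ)), ?_⟩
    rintro _ ⟨k, rfl⟩
    have := h k (1 / K) (by positivity)
    have e : K * (1 / K * X k + D * (1 / K) ^ (-ρ)) = X k + K * (D * (1 / K) ^ (-ρ)) := by
      field_simp
    linarith
  have hl := tendsto_atTop_ciSup hs hbdd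
  set c := ⨆ k, s k
  have hdiff : Tendsto (fun k => B * (s (k + 1) - s k)) atTop (𝓝 0) := by
    have := ((hl.comp (tendsto_add_atTop_nat 1)).sub hl).const_mul B
    simpa using this
  have hX0 : Tendsto X atTop (𝓝 0) := squeeze_zero hX hXs hdiff
  have hc : ∀ l, 0 < l → c ≤ K * (D * l ^ (-ρ)) := by
    intro l hl0
    have h1 : Tendsto (fun k => s k + X k) atTop (𝓝 (c + 0)) := hl.add hX0
    have h2 : Tendsto (fun k => K * (l * X k + D * l ^ (-ρ))) atTop (𝓝 (K * (l * 0 + D * l ^ (-ρ)))) :=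
      ((hX0.const_mul l).add_const _).const_mul K
    have := le_of_tendsto_of_tendsto' h1 h2 (fun k => h k l hl0)
    simpa using this
  have hc0 : c ≤ 0 := by
    have h1 : Tendsto (fun l : ℝ => K * (D * l ^ (-ρ))) atTop (𝓝 (K * (D * 0))) :=
      ((tendsto_rpow_neg_atTop hρ).const_mul D).const_mul K
    simp only [mul_zero] at h1
    refine ge_of_tendsto h1 ?_
    filter_upwards [eventually_gt_atTop 0] with l hl0 using hc l hl0
  intro k
  exact (le_ciSup hbdd k).trans hc0


lemma core_step {n : ℕ} {p α : ℝ} (hp : 1 < p) (hα : 0 < α) (hpα : p ≤ 1 + 2 / α)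
    {u V : EuclideanSpace ℝ (Fin n) → ℝ → ℝ}
    (hu_cont : ContinuousOn (fun q : EuclideanSpace ℝ (Fin n) × ℝ => u q.1 q.2)
      {q : EuclideanSpace ℝ (Fin n) × ℝ | 0 < q.2})
    (hu_space : ∀ t : ℝ, 0 < t → ContDiff ℝ 2 (fun x => u x t))
    (hu_time : ∀ x, ∀ t : ℝ, 0 < t → DifferentiableAt ℝ (fun s => u x s) t)
    (hV_cont : ContinuousOn (fun q : EuclideanSpace ℝ (Fin n) × ℝ => V q.1 q.2)
      {q : EuclideanSpace ℝ (Fin n) × ℝ | 0 < q.2})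
    (hV_pos : ∀ x, ∀ t : ℝ, 0 < t → 0 < V x t)
    (hf_cont : ContinuousOn (fun q : EuclideanSpace ℝ (Fin n) × ℝ => |u q.1 q.2| ^ p * V q.1 q.2)
      {q : EuclideanSpace ℝ (Fin n) × ℝ | 0 < q.2})
    (hu0 : ∀ x, ∀ t : ℝ, 0 < t → 0 ≤ u x t)
    (hpde : ∀ x, ∀ t : ℝ, 0 < t →
      laplacian (fun y => u y t) x + |u x t| ^ p * V x t ≤ deriv (fun s => u x s) t)
    (x₀ : EuclideanSpace ℝ (Fin n)) {C R a : ℝ} (hC : 0 < C) (hR : 1 ≤ R)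
    (ha : 0 < a) (haR : a ≤ R ^ 2 / 4)
    (hVOL : (∫ t in Ioc (R ^ 2 / 4) (R ^ 2), ∫ x in Metric.ball x₀ R,
            V x t ^ (-(1 / (p - 1)))) ≤ C * R ^ (2 + α)) :
    ∃ X, 0 ≤ X ∧ X ≤ exp (Lc n) * ∫ t in (R ^ 2 / 4)..(R ^ 2),
        (∫ x in Metric.closedBall x₀ R, |u x t| ^ p * V x t * wcut x₀ R x ^ 3) ∧
      ∀ l, 0 < l → (∫ t in a..(R ^ 2 / 4),
        (∫ x in Metric.closedBall x₀ R, |u x t| ^ p * V x t * wcut x₀ R x ^ 3)) + X ≤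
        4 * (p / (p - 1)) / 3 * (l * X + exp (Lc n) * (l ^ (-(1 / (p - 1))) * C)) := by
  have hR0 : 0 < R := by linarith
  have hp1 : 0 < p - 1 := by linarith
  have hw := wcut_continuous x₀ R
  have hwp : ContinuousOn (fun q : EuclideanSpace ℝ (Fin n) × ℝ => wcut x₀ R q.1 ^ 3)
      {q : EuclideanSpace ℝ (Fin n) × ℝ | 0 < q.2} := by
    have : Continuous (fun q : EuclideanSpace ℝ (Fin n) × ℝ => wcut x₀ R q.1 ^ 3) := by fun_prop
    exact this.continuousOn
  have hNc : ContinuousOn (fun q : EuclideanSpace ℝ (Fin n) × ℝ => V q.1 q.2 ^ (-(1 / (p - 1))))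
      {q : EuclideanSpace ℝ (Fin n) × ℝ | 0 < q.2} :=
    hV_cont.rpow_const (fun q hq => Or.inl (hV_pos _ _ hq).ne')
  have hw0 : ∀ x, 0 ≤ wcut x₀ R x ^ 3 := fun x => pow_nonneg (wcut_nonneg x₀ R x) 3
  have hw1 : ∀ x, wcut x₀ R x ^ 3 ≤ 1 :=
    fun x => pow_le_one₀ (wcut_nonneg x₀ R x) (wcut_le_one x₀ R x)
  have hf0 : ∀ x, ∀ t : ℝ, 0 < t → 0 ≤ |u x t| ^ p * V x t := fun x t ht =>
    mul_nonneg (Real.rpow_nonneg (abs_nonneg _) _) (hV_pos x t ht).le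
  have hN0 : ∀ x, ∀ t : ℝ, 0 < t → 0 ≤ V x t ^ (-(1 / (p - 1))) := fun x t ht =>
    Real.rpow_nonneg (hV_pos x t ht).le _
  refine core_est (fun t => ∫ x in Metric.closedBall x₀ R, u x t * wcut x₀ R x ^ 3)
    (fun t => ∫ x in Metric.closedBall x₀ R, |u x t| ^ p * V x t * wcut x₀ R x ^ 3)
    (fun t => ∫ x in Metric.closedBall x₀ R, V x t ^ (-(1 / (p - 1))))
    R (Lc n) (p / (p - 1)) a C (1 / (p - 1)) hR0 (Lc_nonneg n) ?_ ha haR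
    (continuousOn_ballIntegral (fun x t => u x t * wcut x₀ R x ^ 3) (hu_cont.mul hwp) x₀ R)
    (continuousOn_ballIntegral (fun x t => |u x t| ^ p * V x t * wcut x₀ R x ^ 3)
      (hf_cont.mul hwp) x₀ R)
    (continuousOn_ballIntegral (fun x t => V x t ^ (-(1 / (p - 1)))) hNc x₀ R)
    (fun t ht => integral_nonneg fun x => mul_nonneg (hu0 x t ht) (hw0 x))
    (fun t ht => integral_nonneg fun x => mul_nonneg (hf0 x t ht) (hw0 x))
    (fun t ht => integral_nonneg fun x => hN0 x t ht)
    (fun t ht ε hε => dini_F u (fun x t => |u x t| ^ p * V x t) hu_cont hu_space hu_time hf_cont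
      hpde hu0 x₀ R t ε hR0 ht hε) ?_ ?_
  · rw [le_div_iff₀ hp1]; linarith
  · intro t ht y hy l hl
    have hm : 0 ≤ (R ^ 2)⁻¹ := by positivity
    have cu := (continuous_slice hu_cont ht)
    have cf := (continuous_slice (g := fun x t => |u x t| ^ p * V x t) hf_cont ht)
    have cN := (continuous_slice (g := fun x t => V x t ^ (-(1 / (p - 1)))) hNc ht)
    have i1 : IntegrableOn (fun x => u x t * wcut x₀ R x ^ 3) (Metric.closedBall x₀ R) :=
      integrableOn_closedBall (cu.mul (hw.pow 3)) x₀ R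
    have i2 : IntegrableOn (fun x => |u x t| ^ p * V x t * wcut x₀ R x ^ 3)
        (Metric.closedBall x₀ R) :=
      integrableOn_closedBall (cf.mul (hw.pow 3)) x₀ R
    have i3 := integrableOn_closedBall cN x₀ R
    simp only [← integral_const_mul]
    rw [← integral_add ((i2.const_mul _).const_mul _) ((i3.const_mul _).const_mul _)]
    refine integral_mono (i1.const_mul _)
      (((i2.const_mul _).const_mul _).add ((i3.const_mul _).const_mul _)) ?_
    intro x
    have h := mul_le_mul_of_nonneg_right
      (young_pointwise hp (hu0 x t ht) (hV_pos x t ht) hy hl hm) (hw0 x)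
    have h2 : 0 ≤ l ^ (-(1 / (p - 1))) * (((R ^ 2)⁻¹) ^ (p / (p - 1)) * V x t ^ (-(1 / (p - 1)))) := by
      have := hN0 x t ht
      positivity
    have h3 := mul_le_mul_of_nonneg_left (hw1 x) h2
    simp only
    linarith
  · have hbR : R ^ 2 / 4 ≤ R ^ 2 := by nlinarith
    have hb : ∀ t, ∫ x in Metric.closedBall x₀ R, V x t ^ (-(1 / (p - 1))) =
        ∫ x in Metric.ball x₀ R, V x t ^ (-(1 / (p - 1))) := by
      intro t
      apply setIntegral_congr_set
      have hs : volume (Metric.sphere x₀ R) = 0 :=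
        Measure.addHaar_sphere_of_ne_zero volume x₀ hR0.ne'
      rw [← Metric.ball_union_sphere]
      exact union_ae_eq_left_of_ae_eq_empty (by rwa [ae_eq_empty])
    simp only [hb]
    rw [intervalIntegral.integral_of_le hbR]
    have hm : 0 ≤ ((R ^ 2)⁻¹) ^ (p / (p - 1)) := by positivity
    refine (mul_le_mul_of_nonneg_left hVOL hm).trans ?_
    have e1 : ((R ^ 2)⁻¹) ^ (p / (p - 1)) = R ^ (-(2 * (p / (p - 1)))) := by
      rw [← Real.rpow_natCast, ← Real.rpow_neg hR0.le, ← Real.rpow_mul hR0.le]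
      congr 1
      push_cast
      ring
    have e2 : R ^ (-(2 * (p / (p - 1)))) * (C * R ^ (2 + α)) =
        C * R ^ (-(2 * (p / (p - 1))) + (2 + α)) := by
      rw [Real.rpow_add hR0 (-(2 * (p / (p - 1)))) (2 + α)]; ring
    rw [e1, e2]
    have h3 : -(2 * (p / (p - 1))) + (2 + α) ≤ 0 := by
      have h4 : (p - 1) * α ≤ 2 := by
        have : p - 1 ≤ 2 / α := by linarith
        rwa [le_div_iff₀ hα] at this
      have h5 : p / (p - 1) = 1 + 1 / (p - 1) := by field_simp; ring
      have h6 : α ≤ 2 * (1 / (p - 1)) := by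
        rw [mul_one_div, le_div_iff₀ hp1]; linarith
      rw [h5]; linarith
    have := Real.rpow_le_one_of_one_le_of_nonpos hR h3
    nlinarith

/-- Liouville theorem for bounded-below classical supersolutions of `u_t ≥ Δu + |u|^p V` on
`ℝⁿ × (0,∞)` with nonnegative initial datum, under the (VOL) conditions on the weight `V`
with exponent `α`, for `1 < p ≤ 1 + 2/α`. -/
theorem triviality_weighted_superlinear_heat_supersolution
    {n : ℕ} (p α : ℝ) (hp : 1 < p) (hα : 0 < α) (hpα : p ≤ 1 + 2 / α)
    (u V : EuclideanSpace ℝ (Fin n) → ℝ → ℝ)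
    -- u is continuous up to t = 0
    (hu_cont : ContinuousOn (fun q : EuclideanSpace ℝ (Fin n) × ℝ => u q.1 q.2)
      {q : EuclideanSpace ℝ (Fin n) × ℝ | 0 ≤ q.2})
    -- u is C² in the space variable for every t > 0
    (hu_space : ∀ t : ℝ, 0 < t → ContDiff ℝ 2 (fun x => u x t))
    -- u is C¹ in the time variable on (0,∞)
    (hu_time : ∀ x, ContDiffOn ℝ 1 (fun s => u x s) (Ioi 0))
    -- V is continuous on ℝⁿ × (0,∞)
    (hV_cont : ContinuousOn (fun q : EuclideanSpace ℝ (Fin n) × ℝ => V q.1 q.2)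
      {q : EuclideanSpace ℝ (Fin n) × ℝ | 0 < q.2})
    -- V is positive
    (hV_pos : ∀ x, ∀ t : ℝ, 0 < t → 0 < V x t)
    -- u is bounded from below
    (hbelow : ∃ A : ℝ, ∀ x, ∀ t : ℝ, 0 ≤ t → A ≤ u x t)
    -- nonnegative initial datum
    (h0 : ∀ x, 0 ≤ u x 0)
    -- u is a supersolution: u_t ≥ Δu + |u|^p V on ℝⁿ × (0,∞)
    (hpde : ∀ x, ∀ t : ℝ, 0 < t →
      deriv (fun s => u x s) t ≥ laplacian (fun y => u y t) x + |u x t| ^ p * V x t)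
    -- the conditions (VOL) with exponent α
    (hVOL : ∃ x₀ : EuclideanSpace ℝ (Fin n), ∃ C R₀ : ℝ, 0 < C ∧ 0 < R₀ ∧
      ∀ R : ℝ, R₀ ≤ R →
        (∫ t in Ioc (R ^ 2 / 4) (R ^ 2), ∫ x in Metric.ball x₀ R,
            V x t ^ (-(1 / (p - 1)))) ≤ C * R ^ (2 + α) ∧
        (∫ t in Ioc (0 : ℝ) (R ^ 2), ∫ x in Metric.ball x₀ R \ Metric.ball x₀ (R / 2),
            V x t ^ (-(1 / (p - 1)))) ≤ C * R ^ (2 + α)) :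
    ∀ x, ∀ t : ℝ, 0 ≤ t → u x t = 0 := by
  obtain ⟨x₀, C, R₀, hC, hR₀, hVOL⟩ := hVOL
  have hp1 : 0 < p - 1 := by linarith
  have hcu : ContinuousOn (fun q : EuclideanSpace ℝ (Fin n) × ℝ => u q.1 q.2)
      {q : EuclideanSpace ℝ (Fin n) × ℝ | 0 < q.2} := by
    refine hu_cont.mono ?_
    intro q hq
    exact le_of_lt (show 0 < q.2 from hq)
  have hut : ∀ x, ∀ t : ℝ, 0 < t → DifferentiableAt ℝ (fun s => u x s) t := fun x t ht =>
    ((hu_time x).differentiableOn (by norm_num)).differentiableAt (Ioi_mem_nhds ht)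
  have hf0 : ∀ x, ∀ t : ℝ, 0 < t → 0 ≤ |u x t| ^ p * V x t := fun x t ht =>
    mul_nonneg (Real.rpow_nonneg (abs_nonneg _) _) (hV_pos x t ht).le
  have hfc : ContinuousOn (fun q : EuclideanSpace ℝ (Fin n) × ℝ => |u q.1 q.2| ^ p * V q.1 q.2)
      {q : EuclideanSpace ℝ (Fin n) × ℝ | 0 < q.2} :=
    (hcu.abs.rpow_const (fun q _ => Or.inr (by linarith))).mul hV_cont
  have hu0 := supersol_nonneg u hu_cont hu_space hut hbelow h0
    (fun x t ht => by have := hpde x t ht; have := hf0 x t ht; linarith)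
  have main : ∀ x, ∀ t : ℝ, 0 < t → u x t = 0 := by
    intro x t ht
    by_contra hne
    have hpos : 0 < u x t := lt_of_le_of_ne (hu0 x t ht.le) (Ne.symm hne)
    obtain ⟨R₁, hR1, hRR, hRx, hRt⟩ : ∃ R₁ : ℝ, 1 ≤ R₁ ∧ R₀ ≤ R₁ ∧ dist x x₀ < R₁ ∧
        t ≤ R₁ ^ 2 / 4 := by
      refine ⟨1 + R₀ + dist x x₀ + 4 * t, ?_, ?_, ?_, ?_⟩
      · have := dist_nonneg (x := x) (y := x₀); linarith
      · have := dist_nonneg (x := x) (y := x₀); linarith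
      · linarith
      · have := dist_nonneg (x := x) (y := x₀); nlinarith
    set J : ℝ → ℝ → ℝ := fun R t =>
      ∫ x in Metric.closedBall x₀ R, |u x t| ^ p * V x t * wcut x₀ R x ^ 3 with hJ
    have hJI : ∀ R, 0 < R → ∀ t, J R t = ∫ x, |u x t| ^ p * V x t * wcut x₀ R x ^ 3 := by
      intro R hR t
      exact setIntegral_wcut x₀ hR (by intro x hx; simp [hx])
    have hIntg : ∀ R, 0 < R → ∀ t, 0 < t →
        Integrable (fun x => |u x t| ^ p * V x t * wcut x₀ R x ^ 3) := by
      intro R hR t ht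
      refine integrable_of_wcut x₀ hR ?_ (by intro x hx; simp [hx])
      exact (continuous_slice (g := fun x t => |u x t| ^ p * V x t) hfc ht).mul
        ((wcut_continuous x₀ R).pow 3)
    have hJc : ∀ R, ContinuousOn (J R) (Ioi 0) := by
      intro R
      have hwp : ContinuousOn (fun q : EuclideanSpace ℝ (Fin n) × ℝ => wcut x₀ R q.1 ^ 3)
          {q : EuclideanSpace ℝ (Fin n) × ℝ | 0 < q.2} := by
        have hw := wcut_continuous x₀ R
        have : Continuous (fun q : EuclideanSpace ℝ (Fin n) × ℝ => wcut x₀ R q.1 ^ 3) := by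
          fun_prop
        exact this.continuousOn
      exact continuousOn_ballIntegral (fun x t => |u x t| ^ p * V x t * wcut x₀ R x ^ 3)
        (hfc.mul hwp) x₀ R
    have hJ0 : ∀ R, ∀ t, 0 < t → 0 ≤ J R t := fun R t ht => integral_nonneg fun x =>
      mul_nonneg (hf0 x t ht) (pow_nonneg (wcut_nonneg x₀ R x) 3)
    have hJm : ∀ R R', 0 < R → R ≤ R' → ∀ t, 0 < t → J R t ≤ J R' t := by
      intro R R' hR hRR' t ht
      rw [hJI R hR, hJI R' (hR.trans_le hRR')]
      refine integral_mono (hIntg R hR t ht) (hIntg R' (hR.trans_le hRR') t ht) ?_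
      intro x
      exact mul_le_mul_of_nonneg_left
        (pow_le_pow_left₀ (wcut_nonneg x₀ R x) (wcut_mono x₀ hR hRR' x) 3) (hf0 x t ht)
    set Rk : ℕ → ℝ := fun k => 2 ^ k * R₁ with hRk
    have hRk1 : ∀ k, R₁ ≤ Rk k := fun k => by
      have : (1 : ℝ) ≤ 2 ^ k := one_le_pow₀ (by norm_num)
      simp only [hRk]; nlinarith
    have hRks : ∀ k, Rk (k + 1) = 2 * Rk k := fun k => by simp only [hRk]; ring
    have hRk0 : ∀ k, 0 < Rk k := fun k => by linarith [hRk1 k]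
    have ha : 0 < t / 2 := by linarith
    have haR : ∀ k, t / 2 ≤ Rk k ^ 2 / 4 := fun k => by
      have : R₁ ^ 2 ≤ Rk k ^ 2 := by have := hRk1 k; gcongr
      linarith
    have hII : ∀ R a b, 0 < a → a ≤ b → IntervalIntegrable (J R) volume a b := by
      intro R a b ha hab
      apply ContinuousOn.intervalIntegrable
      rw [uIcc_of_le hab]
      exact (hJc R).mono fun s hs => lt_of_lt_of_le ha hs.1
    have hex := fun k => core_step hp hα hpα hcu hu_space hut hV_cont hV_pos hfc
      (fun x t ht => hu0 x t ht.le) (fun x t ht => hpde x t ht) x₀ hC (hR1.trans (hRk1 k)) ha (haR k)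
      (hVOL (Rk k) (hRR.trans (hRk1 k))).1
    choose X hX0 hX1 hX2 using hex
    have hstep : ∀ k, (∫ t in (Rk k ^ 2 / 4)..(Rk k ^ 2), J (Rk k) t) ≤
        (∫ t in (t / 2)..(Rk (k + 1) ^ 2 / 4), J (Rk (k + 1)) t) -
          ∫ t in (t / 2)..(Rk k ^ 2 / 4), J (Rk k) t := by
      intro k
      have e : Rk (k + 1) ^ 2 / 4 = Rk k ^ 2 := by rw [hRks]; ring
      have hk := hRk0 k
      have hb : Rk k ^ 2 / 4 ≤ Rk k ^ 2 := by nlinarith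
      rw [e, le_sub_iff_add_le', intervalIntegral.integral_add_adjacent_intervals
        (hII _ _ _ ha (haR k)) (hII _ _ _ (by positivity) hb)]
      refine intervalIntegral.integral_mono_on ((haR k).trans hb) (hII _ _ _ ha ((haR k).trans hb))
        (hII _ _ _ ha ((haR k).trans hb)) ?_
      intro s hs
      exact hJm _ _ hk (by rw [hRks]; linarith) s (lt_of_lt_of_le ha hs.1)
    have hJs0 : ∀ k, 0 ≤ ∫ t in (Rk k ^ 2 / 4)..(Rk k ^ 2), J (Rk k) t := by
      intro k
      have hk := hRk0 k
      have hk2 : 0 < Rk k ^ 2 / 4 := by positivity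
      refine intervalIntegral.integral_nonneg (by nlinarith) ?_
      intro s hs
      exact hJ0 _ s (lt_of_lt_of_le hk2 hs.1)
    have hfin := seq_lemma (fun k => ∫ t in (t / 2)..(Rk k ^ 2 / 4), J (Rk k) t) X
      (4 * (p / (p - 1)) / 3) (exp (Lc n)) (exp (Lc n) * C) (1 / (p - 1)) (by positivity)
      (by positivity) hX0
      (fun k => (hX1 k).trans (mul_le_mul_of_nonneg_left (hstep k) (Real.exp_pos _).le))
      (monotone_nat_of_le_succ fun k => by linarith [hstep k, hJs0 k])
      (fun k l hl => by
        refine (hX2 k l hl).trans (le_of_eq ?_)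
        ring) 0
    have hspos : 0 < ∫ s in (t / 2)..(Rk 0 ^ 2 / 4), J (Rk 0) s := by
      have hR00 : Rk 0 = R₁ := by simp [hRk]
      have hR10 : 0 < R₁ := by linarith
      rw [hR00]
      refine intervalIntegral.integral_pos (by linarith)
        ((hJc R₁).mono fun s hs => lt_of_lt_of_le ha hs.1)
        (fun s hs => hJ0 _ s (ha.trans hs.1)) ⟨t, ⟨by linarith, hRt⟩, ?_⟩
      rw [hJI R₁ hR10]
      refine Continuous.integral_pos_of_hasCompactSupport_nonneg_nonzero (x := x) ?_ ?_ ?_ ?_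
      · exact (continuous_slice (g := fun x t => |u x t| ^ p * V x t) hfc ht).mul
          ((wcut_continuous x₀ R₁).pow 3)
      · apply HasCompactSupport.intro (isCompact_closedBall x₀ R₁)
        intro y hy
        simp [wcut_eq_zero x₀ hR10 hy]
      · intro y
        exact mul_nonneg (hf0 y t ht) (pow_nonneg (wcut_nonneg x₀ R₁ y) 3)
      · have h1 := wcut_pos x₀ hR10 (x := x) hRx
        have h2 := hV_pos x t ht
        have h3 : 0 < |u x t| := abs_pos.2 hne
        positivity
    exact absurd hfin (not_le.2 hspos)
  intro x t ht
  rcases ht.eq_or_lt with rfl | ht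
  · have hc : ContinuousOn (fun s => u x s) (Ici 0) :=
      hu_cont.comp (f := fun s => (x, s)) (by fun_prop) (fun s hs => hs)
    have h1 : Filter.Tendsto (fun s => u x s) (nhdsWithin 0 (Ioi 0)) (nhds (u x 0)) :=
      (hc 0 self_mem_Ici).mono_left (nhdsWithin_mono _ Ioi_subset_Ici_self)
    have h2 : Filter.Tendsto (fun s => u x s) (nhdsWithin 0 (Ioi 0)) (nhds 0) := by
      refine tendsto_const_nhds.congr' ?_
      filter_upwards [self_mem_nhdsWithin] with s hs
      exact (main x s hs).symm
    exact tendsto_nhds_unique h1 h2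
  · exact main x t ht
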